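/- arXiv:0901.4191 — 5 statements merged into one kernel-verified Lean document; each statement's English description precedes it below -/
import Mathlib

section
/- Let 0 < α < β < 1 and let T, A, B > 0 be real numbers. Define t₀ = ( (2(β−α))/((1+α)(1−β)) · A/T )^{1/(1−α)} and λ₀ = c₀^{α,β} · A^{(1−β)/(1−α)} T^{(β−α)/(1−α)} / B. Then t₀ > 0, λ₀ > 0, and the pair (t, λ) = (t₀, λ₀) solves the system of equations t²T − λ t^{1+β} B + t^{1+α} A = 0 and t²T/2 − λ t^{1+β} B/(1+β) + t^{1+α} A/(1+α) = 0. -/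
/-- The pair (t₀, λ₀) solves the fibering system Q_λ(tu)=0, E_λ(tu)=0. -/
theorem stmt_0 (α β T A B : ℝ) (hα : 0 < α) (hαβ : α < β) (hβ : β < 1)
    (hT : 0 < T) (hA : 0 < A) (hB : 0 < B)
    (t₀ : ℝ) (ht₀ : t₀ = ((2 * (β - α)) / ((1 + α) * (1 - β)) * (A / T)) ^ ((1 : ℝ) / (1 - α)))
    (c₀ : ℝ) (hc₀ : c₀ = ((1 - α) * (1 + β)) / ((1 - β) * (1 + α)) *
      (((1 + α) * (1 - β)) / (2 * (β - α))) ^ ((β - α) / (1 - α)))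
    (lam₀ : ℝ) (hlam₀ : lam₀ = c₀ * A ^ ((1 - β) / (1 - α)) * T ^ ((β - α) / (1 - α)) / B) :
    0 < t₀ ∧ 0 < lam₀ ∧
    t₀ ^ (2 : ℝ) * T - lam₀ * t₀ ^ (1 + β) * B + t₀ ^ (1 + α) * A = 0 ∧
    t₀ ^ (2 : ℝ) * T / 2 - lam₀ * t₀ ^ (1 + β) * B / (1 + β) + t₀ ^ (1 + α) * A / (1 + α) = 0 := by
  have h1α : 0 < 1 - α := by linarith
  have h1β : 0 < 1 - β := by linarith
  have h1α' : 0 < 1 + α := by linarith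
  have h1β' : 0 < 1 + β := by linarith
  have hβα : 0 < β - α := by linarith
  set k : ℝ := (2 * (β - α)) / ((1 + α) * (1 - β)) with hk
  have hk0 : 0 < k := by positivity
  have hbase : 0 < k * (A / T) := by positivity
  have ht : 0 < t₀ := by rw [ht₀]; positivity
  have hc : 0 < c₀ := by rw [hc₀]; positivity
  have hlam : 0 < lam₀ := by rw [hlam₀]; positivity
  have ht_pow : ∀ r : ℝ, t₀ ^ (r * (1 - α)) = (k * (A / T)) ^ r := fun r => by
    rw [ht₀, ← Real.rpow_mul hbase.le]
    congr 1
    field_simp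
  have hquad : t₀ ^ (2 : ℝ) * T = k * (t₀ ^ (1 + α) * A) := by
    have h := ht_pow 1
    rw [one_mul, Real.rpow_one] at h
    rw [show (2 : ℝ) = (1 + α) + (1 - α) by ring, Real.rpow_add ht, h]
    field_simp
  have hlamB : lam₀ * t₀ ^ (1 + β) * B = (k + 1) * (t₀ ^ (1 + α) * A) := by
    set s : ℝ := (β - α) / (1 - α) with hs
    have h : t₀ ^ (β - α) = k ^ s * (A ^ s / T ^ s) := by
      rw [← Real.div_rpow hA.le hT.le, ← Real.mul_rpow hk0.le (by positivity), ← ht_pow, hs,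
        div_mul_cancel₀ _ h1α.ne']
    have hAs : A ^ ((1 - β) / (1 - α)) * A ^ s = A := by
      rw [← Real.rpow_add hA, hs, ← add_div, show 1 - β + (β - α) = 1 - α by ring,
        div_self h1α.ne', Real.rpow_one]
    have hinv : ((1 + α) * (1 - β)) / (2 * (β - α)) = k⁻¹ := by rw [hk, inv_div]
    have hk1 : ((1 - α) * (1 + β)) / ((1 - β) * (1 + α)) = k + 1 := by
      rw [hk]; field_simp; ring
    have hks : 0 < k ^ s := by positivity
    have hTs : 0 < T ^ s := by positivity
    rw [hlam₀, hc₀, hinv, hk1, Real.inv_rpow hk0.le,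
      show 1 + β = (1 + α) + (β - α) by ring, Real.rpow_add ht, h]
    calc _ = (k + 1) * (t₀ ^ (1 + α) * (A ^ ((1 - β) / (1 - α)) * A ^ s)) := by
          generalize A ^ ((1 - β) / (1 - α)) = x
          field_simp
      _ = _ := by rw [hAs]
  refine ⟨ht, hlam, by rw [hquad, hlamB]; ring, ?_⟩
  rw [hquad, hlamB, hk]
  field_simp
  ring
end

section
/- Let 0 < α < β < 1 and let T, A, B > 0 be real numbers. Define t₁ = ( ((β−α)/(1−β)) · A/T )^{1/(1−α)} and λ₁ = c₁^{α,β} · A^{(1−β)/(1−α)} T^{(β−α)/(1−α)} / B. Then t₁ > 0, λ₁ > 0, and the pair (t, λ) = (t₁, λ₁) solves the system of equations t²T − λ t^{1+β} B + t^{1+α} A = 0 and t²T − λβ t^{1+β} B + α t^{1+α} A = 0. -/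
/-- The pair (t₁, λ₁) solves the fibering system Q_λ(tu)=0, L_λ(tu)=0. -/
theorem stmt_1 (α β T A B : ℝ) (hα : 0 < α) (hαβ : α < β) (hβ : β < 1)
    (hT : 0 < T) (hA : 0 < A) (hB : 0 < B)
    (t₁ : ℝ) (ht₁ : t₁ = ((β - α) / (1 - β) * (A / T)) ^ ((1 : ℝ) / (1 - α)))
    (c₁ : ℝ) (hc₁ : c₁ = (1 - α) / (1 - β) *
      ((1 - β) / (β - α)) ^ ((β - α) / (1 - α)))
    (lam₁ : ℝ) (hlam₁ : lam₁ = c₁ * A ^ ((1 - β) / (1 - α)) * T ^ ((β - α) / (1 - α)) / B) :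
    0 < t₁ ∧ 0 < lam₁ ∧
    t₁ ^ (2 : ℝ) * T - lam₁ * t₁ ^ (1 + β) * B + t₁ ^ (1 + α) * A = 0 ∧
    t₁ ^ (2 : ℝ) * T - lam₁ * β * t₁ ^ (1 + β) * B + α * t₁ ^ (1 + α) * A = 0 := by
  have h1β : 0 < 1 - β := by linarith
  have h1α : 0 < 1 - α := by linarith
  have hβα : 0 < β - α := by linarith
  have ht : 0 < t₁ := by rw [ht₁]; positivity
  have hlam : 0 < lam₁ := by rw [hlam₁, hc₁]; positivity
  have ht_pow : t₁ ^ (1 - α) = (β - α) / (1 - β) * (A / T) := by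
    rw [ht₁, ← Real.rpow_mul (by positivity), one_div_mul_cancel h1α.ne', Real.rpow_one]
  have hlam_mul : lam₁ * B * t₁ ^ (β - α) = (1 - α) / (1 - β) * A := by
    have hexp : (1 - β) / (1 - α) = 1 - (β - α) / (1 - α) := by
      field_simp
      ring
    have hts : t₁ ^ (β - α) = ((β - α) / (1 - β) * (A / T)) ^ ((β - α) / (1 - α)) := by
      rw [ht₁, ← Real.rpow_mul (by positivity), one_div_mul_eq_div]
    rw [hts, hlam₁, hc₁, hexp, Real.rpow_sub hA, Real.rpow_one,
      Real.mul_rpow (by positivity) (by positivity), Real.div_rpow h1β.le hβα.le,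
      Real.div_rpow hβα.le h1β.le, Real.div_rpow hA.le hT.le]
    have hP := Real.rpow_pos_of_pos h1β ((β - α) / (1 - α))
    have hQ := Real.rpow_pos_of_pos hβα ((β - α) / (1 - α))
    have hR := Real.rpow_pos_of_pos hA ((β - α) / (1 - α))
    have hS := Real.rpow_pos_of_pos hT ((β - α) / (1 - α))
    generalize (1 - β) ^ ((β - α) / (1 - α)) = P at *
    generalize (β - α) ^ ((β - α) / (1 - α)) = Q at *
    generalize A ^ ((β - α) / (1 - α)) = R at *
    generalize T ^ ((β - α) / (1 - α)) = S at *
    field_simp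
  have hsq : t₁ ^ (2 : ℝ) * T = t₁ ^ (1 + α) * ((β - α) / (1 - β) * A) := by
    rw [show (2 : ℝ) = (1 + α) + (1 - α) by ring, Real.rpow_add ht, ht_pow]
    field_simp
  have hβ_term : lam₁ * t₁ ^ (1 + β) * B = t₁ ^ (1 + α) * ((1 - α) / (1 - β) * A) := by
    rw [show 1 + β = (1 + α) + (β - α) by ring, Real.rpow_add ht, ← hlam_mul]
    ring
  refine ⟨ht, hlam, ?_, ?_⟩
  · rw [hsq, hβ_term]
    field_simp
    ring
  · rw [hsq, show lam₁ * β * t₁ ^ (1 + β) * B = β * (lam₁ * t₁ ^ (1 + β) * B) by ring, hβ_term]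
    field_simp
    ring
end

section
/- For all real numbers α, β with 0 < α < β < 1, one has c₁^{α,β} < c₀^{α,β}; equivalently, (2/(1+α))^{(β−α)/(1−α)} < (1+β)/(1+α). (This is the inequality behind the strict ordering Λ₁ < Λ₀ of the two spectral points of the fibering procedure.) -/
/-- Strict concavity of `x ↦ x ^ t` with `t = (β - α) / (1 - α)`, in the form of Bernoulli's
inequality. -/
lemma two_div_one_add_rpow_lt {α β : ℝ} (hα : -1 < α) (hαβ : α < β) (hβ : β < 1) :
    (2 / (1 + α)) ^ ((β - α) / (1 - α)) < (1 + β) / (1 + α) := by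
  have h₁ : 0 < 1 + α := by linarith
  have h₂ : 0 < 1 - α := by linarith
  have hs : 0 < (1 - α) / (1 + α) := div_pos h₂ h₁
  have ht : 0 < (β - α) / (1 - α) := div_pos (by linarith) h₂
  have ht' : (β - α) / (1 - α) < 1 := (div_lt_one h₂).2 (by linarith)
  have h := rpow_one_add_lt_one_add_mul_self (by linarith) hs.ne' ht ht'
  have hl : 1 + (1 - α) / (1 + α) = 2 / (1 + α) := by field_simp; ring
  have hr : 1 + (β - α) / (1 - α) * ((1 - α) / (1 + α)) = (1 + β) / (1 + α) := by
    field_simp; ring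
  rwa [hl, hr] at h

/-- c₁^{α,β} < c₀^{α,β}, equivalently (2/(1+α))^{(β-α)/(1-α)} < (1+β)/(1+α). -/
theorem stmt_2 (α β : ℝ) (hα : 0 < α) (hαβ : α < β) (hβ : β < 1) :
    (1 - α) / (1 - β) * ((1 - β) / (β - α)) ^ ((β - α) / (1 - α)) <
      ((1 - α) * (1 + β)) / ((1 - β) * (1 + α)) *
        (((1 + α) * (1 - β)) / (2 * (β - α))) ^ ((β - α) / (1 - α)) ∧
    (2 / (1 + α)) ^ ((β - α) / (1 - α)) < (1 + β) / (1 + α) := by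
  have key := two_div_one_add_rpow_lt (by linarith) hαβ hβ
  refine ⟨?_, key⟩
  have h₁ : 0 < 1 + α := by linarith
  have h₂ : 0 < 1 - α := by linarith
  have h₃ : 0 < 1 - β := by linarith
  have h₄ : 0 < β - α := by linarith
  have hbase : (1 - β) / (β - α) =
      2 / (1 + α) * (((1 + α) * (1 - β)) / (2 * (β - α))) := by field_simp
  have hfac : ((1 - α) * (1 + β)) / ((1 - β) * (1 + α)) =
      (1 - α) / (1 - β) * ((1 + β) / (1 + α)) := mul_div_mul_comm ..
  rw [hbase, Real.mul_rpow (by positivity) (by positivity), hfac, mul_assoc]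
  gcongr
end

section
/- Let n ≥ 3 be an integer and 0 < α < β < 1 with θ := 2(1+α)(1+β) − n(1−α)(1−β) < 0. Let λ > 0, t > 0 and T, A, B > 0 be real numbers. If t²T − λ t^{1+β} B + t^{1+α} A = 0 and ((n−2)/(2n)) t²T − λ t^{1+β} B/(1+β) + t^{1+α} A/(1+α) ≤ 0, then t²T − λβ t^{1+β} B + α t^{1+α} A > 0. -/
/-- if θ < 0, Q_λ(tu) = 0 and P_λ(tu) ≤ 0 then L_λ(tu) > 0. -/
theorem stmt_6 (n : ℕ) (hn : 3 ≤ n) (α β : ℝ) (hα : 0 < α) (hαβ : α < β) (hβ : β < 1)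
    (hθ : 2 * (1 + α) * (1 + β) - (n : ℝ) * (1 - α) * (1 - β) < 0)
    (lam t T A B : ℝ) (hlam : 0 < lam) (ht : 0 < t)
    (hT : 0 < T) (hA : 0 < A) (hB : 0 < B)
    (hQ : t ^ (2 : ℝ) * T - lam * t ^ (1 + β) * B + t ^ (1 + α) * A = 0)
    (hP : ((n : ℝ) - 2) / (2 * n) * t ^ (2 : ℝ) * T - lam * t ^ (1 + β) * B / (1 + β)
        + t ^ (1 + α) * A / (1 + α) ≤ 0) :
    0 < t ^ (2 : ℝ) * T - lam * β * t ^ (1 + β) * B + α * t ^ (1 + α) * A := by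
  have hn0 : (0 : ℝ) < n := by exact_mod_cast (by omega : 0 < n)
  have hα1 : 0 < 1 + α := by linarith
  have hβ1 : 0 < 1 + β := by linarith
  have hx : 0 < t ^ (2 : ℝ) * T := by positivity
  have hP' : ((n : ℝ) - 2) / (2 * n) * (t ^ (2 : ℝ) * T) - lam * t ^ (1 + β) * B / (1 + β)
      + t ^ (1 + α) * A / (1 + α) ≤ 0 := by
    simpa only [mul_assoc] using hP
  have hL : t ^ (2 : ℝ) * T - lam * β * t ^ (1 + β) * B + α * t ^ (1 + α) * A
      = t ^ (2 : ℝ) * T - β * (lam * t ^ (1 + β) * B) + α * (t ^ (1 + α) * A) := by ring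
  rw [hL]
  generalize t ^ (2 : ℝ) * T = x at *
  generalize lam * t ^ (1 + β) * B = b at *
  generalize t ^ (1 + α) * A = a at *
  obtain rfl : b = x + a := by linarith
  have hP_cleared : (n - 2) * (1 + α) * (1 + β) * x - 2 * n * (1 + α) * (x + a)
      + 2 * n * (1 + β) * a ≤ 0 := by
    have h := mul_nonpos_of_nonneg_of_nonpos
      (by positivity : 0 ≤ 2 * n * (1 + α) * (1 + β)) hP'
    refine le_of_eq_of_le ?_ h
    field_simp
  have hθx := mul_neg_of_neg_of_pos hθ hx
  refine pos_of_mul_pos_right (a := 2 * (n : ℝ)) ?_ (by positivity)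
  linarith
end

section
/- Let 0 < α < β < 1, let p > 1 be such that ε := β − 1 + (1−α)/p > 0, and let λ > 0, C₀ > 0, K > 0. Then there exist real numbers 0 < t_min ≤ t_max < ∞ such that: whenever t > 0 and A, B are reals with 0 < A ≤ K, 0 < B ≤ C₀ · A^{1/p}, and 1 − λ t^{β−1} B + t^{α−1} A = 0, one has t_min ≤ t ≤ t_max. -/
/-- the scaling parameters of the minimizing sequence are bounded
and bounded away from zero. -/
theorem stmt_10 (α β : ℝ) (hα : 0 < α) (hαβ : α < β) (hβ : β < 1)
    (p : ℝ) (hp : 1 < p) (hε : 0 < β - 1 + (1 - α) / p)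
    (lam C₀ K : ℝ) (hlam : 0 < lam) (hC₀ : 0 < C₀) (hK : 0 < K) :
    ∃ t_min t_max : ℝ, 0 < t_min ∧ t_min ≤ t_max ∧
      ∀ t A B : ℝ, 0 < t → 0 < A → A ≤ K → 0 < B → B ≤ C₀ * A ^ (1 / p) →
        1 - lam * t ^ (β - 1) * B + t ^ (α - 1) * A = 0 →
        t_min ≤ t ∧ t ≤ t_max := by
  have hp₀ : 0 < p := by linarith
  refine ⟨(1 / (lam * C₀)) ^ (β - 1 + (1 - α) / p)⁻¹,
    max ((1 / (lam * C₀)) ^ (β - 1 + (1 - α) / p)⁻¹)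
      ((lam * C₀ * K ^ (1 / p)) ^ (1 - β)⁻¹),
    by positivity, le_max_left _ _, fun t A B ht hA hAK _ hBA h => ?_⟩
  have hs : 0 < t ^ (α - 1) * A := by positivity
  have hle : 1 + t ^ (α - 1) * A ≤ lam * C₀ * (t ^ (β - 1) * A ^ (1 / p)) := by
    have := mul_le_mul_of_nonneg_left hBA (by positivity : 0 ≤ lam * t ^ (β - 1))
    linarith
  constructor
  · rw [Real.rpow_inv_le_iff_of_pos (by positivity) ht.le hε, div_le_iff₀ (by positivity)]
    have hscale : t ^ (β - 1) * A ^ (1 / p) =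
        t ^ (β - 1 + (1 - α) / p) * (t ^ (α - 1) * A) ^ (1 / p) := by
      rw [Real.mul_rpow (by positivity) hA.le, ← Real.rpow_mul ht.le, ← mul_assoc,
        ← Real.rpow_add ht]
      congr 2
      ring
    have hroot : (t ^ (α - 1) * A) ^ (1 / p) ≤ 1 + t ^ (α - 1) * A :=
      calc (t ^ (α - 1) * A) ^ (1 / p) ≤ (1 + t ^ (α - 1) * A) ^ (1 / p) :=
            Real.rpow_le_rpow hs.le (by linarith) (by positivity)
        _ ≤ (1 + t ^ (α - 1) * A) ^ (1 : ℝ) :=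
            Real.rpow_le_rpow_of_exponent_le (by linarith)
              ((div_le_one hp₀).2 hp.le)
        _ = 1 + t ^ (α - 1) * A := Real.rpow_one _
    rw [hscale] at hle
    have := mul_le_mul_of_nonneg_left hroot
      (by positivity : 0 ≤ lam * C₀ * t ^ (β - 1 + (1 - α) / p))
    refine le_of_mul_le_mul_right ?_ (by linarith : 0 < 1 + t ^ (α - 1) * A)
    linarith
  · refine le_max_of_le_right ?_
    rw [Real.le_rpow_inv_iff_of_pos ht.le (by positivity) (by linarith)]
    have hAK' : A ^ (1 / p) ≤ K ^ (1 / p) := Real.rpow_le_rpow hA.le hAK (by positivity)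
    have hinv : t ^ (1 - β) * t ^ (β - 1) = 1 := by
      rw [← Real.rpow_add ht]
      simp
    calc t ^ (1 - β) = t ^ (1 - β) * 1 := (mul_one _).symm
      _ ≤ t ^ (1 - β) * (lam * C₀ * (t ^ (β - 1) * A ^ (1 / p))) := by
          gcongr
          linarith
      _ = (t ^ (1 - β) * t ^ (β - 1)) * (lam * C₀ * A ^ (1 / p)) := by ring
      _ = lam * C₀ * A ^ (1 / p) := by rw [hinv, one_mul]
      _ ≤ lam * C₀ * K ^ (1 / p) := by gcongr
end
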